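/- arXiv:1801.08745 — 2 statements merged into one kernel-verified Lean document; each statement's English description precedes it below -/
import Mathlib

section
/- Let a > 0 and 0 ≤ D < 1/2. Let f : [0,a] → ℝ be a 1-Lipschitz function, piecewise linear on every closed subinterval of (0,a], with f(0) = 0 and f(x) ≥ Dx for every x ∈ [0,a]. Set Φ(D) = (2 − D − √(3 − 3D²))/4. Then for every δ ∈ (0,1/2) there exists u ∈ [3aΦ(D)·2^{−1/δ}, a] such that T(f|[0,u]) < u·(Φ(D) + δ(2 − 4log₂δ)). -/
open Set

/-- A good partition of `[0,a]`: a strictly decreasing sequence `a = a₀ > a₁ > … > 0`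
tending to `0` with `a_{n-1}/a_n ≤ 2`. -/
def IsGoodPartition (a : ℝ) (u : ℕ → ℝ) : Prop :=
  u 0 = a ∧ (∀ n, 0 < u n) ∧ (∀ n, u (n + 1) < u n) ∧
    Filter.Tendsto u Filter.atTop (nhds 0) ∧ ∀ n, u n ≤ 2 * u (n + 1)

/-- A `τ`-good partition: a good partition with `a_{n-1}/a_n ≥ 1 + τ`. -/
def IsTauGoodPartition (τ a : ℝ) (u : ℕ → ℝ) : Prop :=
  IsGoodPartition a u ∧ ∀ n, (1 + τ) * u (n + 1) ≤ u n

/-- The total drop of `f` according to the partition `(a_n)`: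
`T(f,(a_n)) = Σ_{n≥1} (f(a_n) − min_{[a_n, a_{n-1}]} f)`. -/
noncomputable def totalDrop (f : ℝ → ℝ) (u : ℕ → ℝ) : ℝ :=
  ∑' n : ℕ, (f (u (n + 1)) - sInf (f '' Set.Icc (u (n + 1)) (u n)))

/-- `T(f)`: the infimum of the total drop over all good partitions of `[0,a]`. -/
noncomputable def drop (a : ℝ) (f : ℝ → ℝ) : ℝ :=
  sInf {t | ∃ u, IsGoodPartition a u ∧ t = totalDrop f u}

/-- `T_τ(f)`: the infimum of the total drop over all `τ`-good partitions of `[0,a]`. -/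
noncomputable def dropTau (τ a : ℝ) (f : ℝ → ℝ) : ℝ :=
  sInf {t | ∃ u, IsTauGoodPartition τ a u ∧ t = totalDrop f u}

/-- `f` is piecewise linear on `[c,b]`: the interval splits into finitely many subintervals
on each of which `f` is (affine) linear. -/
def PiecewiseLinearOn (f : ℝ → ℝ) (c b : ℝ) : Prop :=
  ∃ (n : ℕ) (t : ℕ → ℝ), t 0 = c ∧ t n = b ∧ (∀ i, i < n → t i ≤ t (i + 1)) ∧
    ∀ i, i < n → ∃ p q : ℝ, ∀ x ∈ Set.Icc (t i) (t (i + 1)), f x = p * x + q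

section TotalDrop

variable {a : ℝ} {f : ℝ → ℝ}

lemma IsGoodPartition.mem_Icc {y : ℝ} {u : ℕ → ℝ} (hu : IsGoodPartition y u) (n : ℕ) :
    u n ∈ Icc 0 y := by
  obtain ⟨h0, hpos, hlt, -, -⟩ := hu
  exact ⟨(hpos n).le, h0 ▸ antitone_nat_of_succ_le (fun n => (hlt n).le) (Nat.zero_le n)⟩

lemma le_sInf_image_Icc {x y m : ℝ} (hxy : x ≤ y) (hm : ∀ w ∈ Icc x y, m ≤ f w) :
    m ≤ sInf (f '' Icc x y) := by
  refine le_csInf ((nonempty_Icc.2 hxy).image f) ?_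
  rintro _ ⟨w, hw, rfl⟩
  exact hm w hw

lemma sInf_image_Icc_le (hf : LipschitzOnWith 1 f (Icc 0 a)) {x y w : ℝ} (hx : 0 ≤ x)
    (hy : y ≤ a) (hw : w ∈ Icc x y) : sInf (f '' Icc x y) ≤ f w :=
  csInf_le (isCompact_Icc.image_of_continuousOn
    (hf.continuousOn.mono (Icc_subset_Icc hx hy))).bddBelow (mem_image_of_mem f hw)

lemma sub_le_of_lipschitzOn (hf : LipschitzOnWith 1 f (Icc 0 a)) {x y : ℝ} (hx : 0 ≤ x)
    (hxy : x ≤ y) (hy : y ≤ a) : f x - f y ≤ y - x ∧ f y - f x ≤ y - x := by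
  have h := hf.dist_le_mul x ⟨hx, hxy.trans hy⟩ y ⟨hx.trans hxy, hy⟩
  rw [Real.dist_eq, Real.dist_eq, NNReal.coe_one, one_mul, abs_sub_comm x y,
    abs_of_nonneg (sub_nonneg.2 hxy), abs_le] at h
  constructor <;> linarith [h.1, h.2]

/-- The drop of `f` over a single interval. -/
noncomputable def localDrop (f : ℝ → ℝ) (x y : ℝ) : ℝ := f x - sInf (f '' Icc x y)

lemma localDrop_nonneg (hf : LipschitzOnWith 1 f (Icc 0 a)) {x y : ℝ} (hx : 0 ≤ x)
    (hxy : x ≤ y) (hy : y ≤ a) : 0 ≤ localDrop f x y :=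
  sub_nonneg.2 (sInf_image_Icc_le hf hx hy ⟨le_rfl, hxy⟩)

lemma localDrop_le {x y m : ℝ} (hxy : x ≤ y) (hm : ∀ w ∈ Icc x y, m ≤ f w) :
    localDrop f x y ≤ f x - m :=
  sub_le_sub_left (le_sInf_image_Icc hxy hm) _

lemma localDrop_le_half (hf : LipschitzOnWith 1 f (Icc 0 a)) {x y : ℝ} (hx : 0 ≤ x)
    (hxy : x ≤ y) (hy : y ≤ a) : localDrop f x y ≤ ((y - x) + (f x - f y)) / 2 := by
  refine (localDrop_le (m := f x - ((y - x) + (f x - f y)) / 2) hxy fun w hw => ?_).trans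
    (by linarith)
  have h1 := (sub_le_of_lipschitzOn hf hx hw.1 (hw.2.trans hy)).1
  have h2 := (sub_le_of_lipschitzOn hf (hx.trans hw.1) hw.2 hy).2
  linarith

lemma hasSum_sub_succ {u : ℕ → ℝ} (hu : ∀ n, u (n + 1) ≤ u n) {l : ℝ}
    (hl : Filter.Tendsto u Filter.atTop (nhds l)) :
    HasSum (fun n => u n - u (n + 1)) (u 0 - l) := by
  rw [hasSum_iff_tendsto_nat_of_nonneg fun n => sub_nonneg.2 (hu n)]
  simp_rw [Finset.sum_range_sub']
  exact hl.const_sub _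

lemma summable_localDrop (hf : LipschitzOnWith 1 f (Icc 0 a)) {y : ℝ} (hy : y ≤ a)
    {u : ℕ → ℝ} (hu : IsGoodPartition y u) :
    Summable fun n => localDrop f (u (n + 1)) (u n) := by
  have hle := fun n => (hu.2.2.1 n).le
  refine Summable.of_nonneg_of_le (fun n => ?_) (fun n => ?_)
    (hasSum_sub_succ hle hu.2.2.2.1).summable
  · exact localDrop_nonneg hf (hu.mem_Icc _).1 (hle n) ((hu.mem_Icc n).2.trans hy)
  · have h0 := (hu.mem_Icc (n + 1)).1
    have ha := (hu.mem_Icc n).2.trans hy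
    have := localDrop_le_half hf h0 (hle n) ha
    linarith [(sub_le_of_lipschitzOn hf h0 (hle n) ha).1]

lemma totalDrop_nonneg (hf : LipschitzOnWith 1 f (Icc 0 a)) {y : ℝ} (hy : y ≤ a)
    {u : ℕ → ℝ} (hu : IsGoodPartition y u) : 0 ≤ totalDrop f u :=
  tsum_nonneg fun n => localDrop_nonneg hf (hu.mem_Icc _).1 (hu.2.2.1 n).le
    ((hu.mem_Icc n).2.trans hy)

lemma drop_le_totalDrop (hf : LipschitzOnWith 1 f (Icc 0 a)) {y : ℝ} (hy : y ≤ a)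
    {u : ℕ → ℝ} (hu : IsGoodPartition y u) : drop y f ≤ totalDrop f u := by
  refine csInf_le ⟨0, ?_⟩ ⟨u, hu, rfl⟩
  rintro _ ⟨v, hv, rfl⟩
  exact totalDrop_nonneg hf hy hv

lemma isGoodPartition_dyadic {y : ℝ} (hy : 0 < y) :
    IsGoodPartition y fun n => y * (1 / 2) ^ n := by
  refine ⟨by simp, fun n => by positivity, fun n => ?_, ?_, fun n => ?_⟩
  · have : 0 < y * (1 / 2) ^ n := by positivity
    simp only [pow_succ]
    linarith
  · simpa using (tendsto_pow_atTop_nhds_zero_of_lt_one (r := (1 / 2 : ℝ))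
      (by norm_num) (by norm_num)).const_mul y
  · simp only [pow_succ]
    linarith

lemma drop_le_half (hf : LipschitzOnWith 1 f (Icc 0 a)) (h0 : f 0 = 0) {y : ℝ} (hy0 : 0 < y)
    (hy : y ≤ a) : drop y f ≤ (y - f y) / 2 := by
  have hu := isGoodPartition_dyadic hy0
  refine (drop_le_totalDrop hf hy hu).trans ?_
  set u : ℕ → ℝ := fun n => y * (1 / 2) ^ n
  have hle := fun n => (hu.2.2.1 n).le
  have hfu : Filter.Tendsto (fun n => f (u n)) Filter.atTop (nhds 0) := by
    have h := (hf.continuousOn 0 ⟨le_rfl, hy0.le.trans hy⟩).tendsto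
    rw [h0] at h
    refine h.comp (tendsto_nhdsWithin_iff.2 ⟨hu.2.2.2.1, ?_⟩)
    exact .of_forall fun n => ⟨(hu.mem_Icc n).1, (hu.mem_Icc n).2.trans hy⟩
  have hsum : HasSum (fun n => ((u n - f (u n)) - (u (n + 1) - f (u (n + 1)))) / 2)
      (((u 0 - f (u 0)) - (0 - 0)) / 2) := by
    refine (hasSum_sub_succ (u := fun n => u n - f (u n)) (fun n => ?_)
      (hu.2.2.2.1.sub hfu)).div_const 2
    linarith [(sub_le_of_lipschitzOn hf (hu.mem_Icc (n + 1)).1 (hle n)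
      ((hu.mem_Icc n).2.trans hy)).2]
  have hu0 : u 0 = y := hu.1
  have := (summable_localDrop hf hy hu).tsum_le_tsum (fun n => ?_) hsum.summable
  · rw [hsum.tsum_eq, hu0] at this
    simpa [totalDrop, localDrop] using this
  · refine (localDrop_le_half hf (hu.mem_Icc (n + 1)).1 (hle n)
      ((hu.mem_Icc n).2.trans hy)).trans (le_of_eq (by ring))

lemma drop_le_drop_add (hf : LipschitzOnWith 1 f (Icc 0 a)) {x y m : ℝ} (hx : 0 < x)
    (hxy : x < y) (hyx : y ≤ 2 * x) (hy : y ≤ a) (hm : ∀ w ∈ Icc x y, m ≤ f w) :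
    drop y f ≤ drop x f + (f x - m) := by
  rw [← sub_le_iff_le_add]
  refine le_csInf ⟨_, _, isGoodPartition_dyadic hx, rfl⟩ ?_
  rintro _ ⟨u, hu, rfl⟩
  let v : ℕ → ℝ := fun n => Nat.casesOn n y u
  have hv : IsGoodPartition y v := by
    refine ⟨rfl, ?_, ?_, ?_, ?_⟩
    · rintro (_ | n)
      exacts [hx.trans hxy, hu.2.1 n]
    · rintro (_ | n)
      exacts [by simpa [v, hu.1] using hxy, hu.2.2.1 n]
    · exact (Filter.tendsto_add_atTop_iff_nat 1).1 hu.2.2.2.1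
    · rintro (_ | n)
      exacts [by simpa [v, hu.1] using hyx, hu.2.2.2.2 n]
  have h := drop_le_totalDrop hf hy hv
  have hs : totalDrop f v = localDrop f x y + totalDrop f u := by
    have := (summable_localDrop hf hy hv).tsum_eq_zero_add
    simpa [totalDrop, localDrop, v, hu.1] using this
  have := localDrop_le hxy.le hm
  linarith

/-- `y` minimizes `f` on `[y, 2y]`. -/
def IsDoublingMin (a : ℝ) (f : ℝ → ℝ) (y : ℝ) : Prop :=
  ∀ w, y ≤ w → w ≤ 2 * y → w ≤ a → f y ≤ f w

lemma isDoublingMin_or_exists (hf : LipschitzOnWith 1 f (Icc 0 a)) {x : ℝ} (hx : 0 < x)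
    (hxa : x ≤ a) : IsDoublingMin a f x ∨
      ∃ y, x < y ∧ y ≤ 2 * x ∧ y ≤ a ∧ f y < f x ∧ drop y f ≤ drop x f + (f x - f y) ∧
        ∀ w, x ≤ w → w ≤ 2 * x → w ≤ a → f y ≤ f w := by
  obtain ⟨y, hy, hmin⟩ := isCompact_Icc.exists_isMinOn
    (nonempty_Icc.2 (le_min (by linarith : x ≤ 2 * x) hxa))
    (hf.continuousOn.mono (Icc_subset_Icc hx.le (min_le_right (2 * x) a)))
  have hy2 := le_min_iff.1 hy.2
  have hall : ∀ w, x ≤ w → w ≤ 2 * x → w ≤ a → f y ≤ f w := fun w h1 h2 h3 =>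
    isMinOn_iff.1 hmin w ⟨h1, le_min h2 h3⟩
  rcases (hall x le_rfl (by linarith) hxa).lt_or_eq with hlt | heq
  · have hxy : x < y := lt_of_le_of_ne hy.1 (by rintro rfl; exact lt_irrefl _ hlt)
    exact .inr ⟨y, hxy, hy2.1, hy2.2, hlt, drop_le_drop_add hf hx hxy hy2.1 hy2.2
      fun w hw => hall w hw.1 (hw.2.trans hy2.1) (hw.2.trans hy2.2), hall⟩
  · exact .inl fun w h1 h2 h3 => heq ▸ hall w h1 h2 h3

lemma exists_isDoublingMin (hf : LipschitzOnWith 1 f (Icc 0 a)) {x : ℝ} (hx : 0 < x)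
    (hxa : x ≤ a) : ∃ y, x ≤ y ∧ y ≤ a ∧ IsDoublingMin a f y ∧ f y ≤ f x ∧
      drop y f ≤ drop x f + (f x - f y) := by
  obtain ⟨n, hn⟩ : ∃ n : ℕ, a ≤ 2 ^ n * x := by
    obtain ⟨n, hn⟩ := pow_unbounded_of_one_lt (a / x) (one_lt_two (α := ℝ))
    exact ⟨n, ((div_lt_iff₀ hx).1 hn).le⟩
  induction n generalizing x with
  | zero =>
    refine ⟨x, le_rfl, hxa, fun w h1 _ h3 => ?_, le_rfl, by simp⟩
    rw [show w = x by linarith]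
  | succ n ih =>
    rcases isDoublingMin_or_exists hf hx hxa with h | ⟨y, hxy, -, hya, hlt, hd, hall⟩
    · exact ⟨x, le_rfl, hxa, h, le_rfl, by simp⟩
    have hy := hx.trans hxy
    rcases isDoublingMin_or_exists hf hy hya with h | ⟨z, hyz, -, hza, hlt', hd', -⟩
    · exact ⟨y, hxy.le, hya, h, hlt.le, hd⟩
    have hz : 2 * x < z := by
      by_contra! h
      exact absurd (hall z (hxy.trans hyz).le h hza) (not_le.2 hlt')
    obtain ⟨w, h1, h2, h3, h4, h5⟩ := ih (hy.trans hyz) hza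
      (hn.trans (by rw [pow_succ, mul_assoc]; gcongr))
    exact ⟨w, by linarith, h2, h3, by linarith, by linarith⟩

lemma drop_le_or_exists (hf : LipschitzOnWith 1 f (Icc 0 a)) {y B : ℝ} (hy : 0 < y)
    (hya : y ≤ a) (hmin : IsDoublingMin a f y) (hB : drop y f ≤ B) :
    drop a f ≤ B ∨ ∃ U, 2 * y ≤ U ∧ U ≤ a ∧ drop U f ≤ B ∧ f U ≤ f y + U / 2 - y := by
  set S : Set ℝ := {u | u ∈ Icc y a ∧ ∀ w ∈ Icc y u, drop w f ≤ B} with hS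
  have hbdd : BddAbove S := ⟨a, fun u hu => hu.1.2⟩
  have hyS : y ∈ S := ⟨⟨le_rfl, hya⟩, fun w hw => by rwa [le_antisymm hw.2 hw.1]⟩
  set U := sSup S with hU
  have hyU : y ≤ U := le_csSup hbdd hyS
  have hUa : U ≤ a := csSup_le ⟨y, hyS⟩ fun u hu => hu.1.2
  have hlt : ∀ w, y ≤ w → w < U → drop w f ≤ B := fun w hw hwU => by
    obtain ⟨u, hu, hwu⟩ := exists_lt_of_lt_csSup ⟨y, hyS⟩ hwU
    exact hu.2 w ⟨hw, hwu.le⟩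
  have hUB : drop U f ≤ B := by
    rcases hyU.eq_or_lt with h | h
    · rwa [← h]
    refine le_of_forall_pos_le_add fun e he => ?_
    obtain ⟨w, hw1, hw2⟩ := exists_between
      (max_lt (max_lt h (sub_lt_self U he)) (by linarith : U / 2 < U))
    simp only [max_lt_iff] at hw1
    have hw0 : 0 < w := by linarith [hw1.1.1]
    have := drop_le_drop_add (m := f w - (U - w)) hf hw0 hw2 (by linarith [hw1.2]) hUa
      fun s hs => by linarith [(sub_le_of_lipschitzOn hf hw0.le hs.1 (hs.2.trans hUa)).1, hs.2]
    linarith [hlt w hw1.1.1.le hw2, hw1.1.2]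
  have hle : ∀ w, y ≤ w → w ≤ U → drop w f ≤ B := fun w hw hwU =>
    hwU.eq_or_lt.elim (fun h => h ▸ hUB) (hlt w hw)
  rcases hUa.eq_or_lt with h | hUa'
  · exact .inl (h ▸ hUB)
  have hy2U : 2 * y ≤ U := by
    have : min (2 * y) a ∈ S := by
      refine ⟨⟨le_min (by linarith) hya, min_le_right _ _⟩, fun w hw => ?_⟩
      have hw2 := le_min_iff.1 hw.2
      rcases hw.1.eq_or_lt with h | h
      · rwa [← h]
      have := drop_le_drop_add (m := f y) hf hy h hw2.1 hw2.2
        fun s hs => hmin s hs.1 (hs.2.trans hw2.1) (hs.2.trans hw2.2)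
      linarith
    rcases min_le_iff.1 (le_csSup hbdd this) with h | h
    · exact h
    · exact absurd h (not_le.2 hUa')
  refine .inr ⟨U, hy2U, hUa, hUB, ?_⟩
  by_contra! hgap
  set γ := f U - (f y + U / 2 - y) with hγ
  have hγ0 : 0 < γ := by linarith
  have hmem : min a (U + γ / 4) ∈ S := by
    refine ⟨⟨le_min hya (by linarith), min_le_left _ _⟩, fun w hw => ?_⟩
    have hw2 := le_min_iff.1 hw.2
    rcases le_or_gt w U with h | hUw
    · exact hle w hw.1 h
    have hw0 : 0 < w := hy.trans_le hw.1
    obtain ⟨x, hx, hxmin⟩ := isCompact_Icc.exists_isMinOn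
      (nonempty_Icc.2 (by linarith : w / 2 ≤ w))
      (hf.continuousOn.mono (Icc_subset_Icc (by linarith) hw2.1))
    rw [isMinOn_iff] at hxmin
    have h1 := hxmin (w / 2) ⟨le_rfl, by linarith⟩
    have h2 := (sub_le_of_lipschitzOn hf hy.le (by linarith : y ≤ w / 2)
      (by linarith [hw2.1])).2
    have hxU : x < U := by
      by_contra! h
      linarith [(sub_le_of_lipschitzOn hf (hy.le.trans hyU) h (hx.2.trans hw2.1)).1, hx.2]
    have := drop_le_drop_add (m := f x) hf (by linarith [hx.1]) (hxU.trans hUw)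
      (by linarith [hx.1]) hw2.1 fun s hs => hxmin s ⟨hx.1.trans hs.1, hs.2⟩
    linarith [hlt x (by linarith [hx.1]) hxU]
  rcases min_le_iff.1 (le_csSup hbdd hmem) with h | h
  · exact absurd h (not_le.2 hUa')
  · linarith

end TotalDrop

lemma increment_of_step {D q η r r' g : ℝ} (hD0 : 0 ≤ D) (hD : D < 1 / 2) (hq0 : 0 < q)
    (hη0 : 0 < η) (hqη : q * η ≤ 1) (hDq : (1 - 2 * D) ^ 2 * q ≤ 16)
    (hP : 4 ≤ q → q ^ 2 * η / 8 ≤ q * (2 - D) / 2 - 1 - q ^ 2 * (1 - 2 * D) ^ 2 / 16)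
    (hr : 2 ≤ r) (hg : 1 ≤ g) (hgr : (1 + D) * (g - 1) ≤ q * (1 - 2 * D) / 2 - r)
    (hr' : (1 - D) * (3 * g - 3 + 2 * r) ≤ (1 - 2 * D) * (r' * g)) :
    4 ≤ q ∧ g ≤ q ∧ (1 - 2 * D) * q * η / 4 ≤ r' - r := by
  obtain ⟨e, rfl⟩ : ∃ e, D = (1 - e) / 2 := ⟨1 - 2 * D, by ring⟩
  rw [show 1 - 2 * ((1 - e) / 2) = e by ring] at *
  have he0 : 0 < e := by linarith
  have he1 : e ≤ 1 := by linarith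
  have hrq : r ≤ q * e / 2 := by nlinarith
  have hqe : q * e ≤ q := by nlinarith
  have hq4 : 4 ≤ q := by nlinarith
  have hg1 : (1 + (1 - e) / 2) * g ≤ q * e / 2 := by linarith
  have hg2 : g ≤ q * e / 2 := by nlinarith
  refine ⟨hq4, by linarith, ?_⟩
  have hg0 : 0 < g := by linarith
  have heg : 0 < e * g := by positivity
  have key : e * g * (e * q * η / 4) ≤ e * g * (r' - r) := by
    rcases le_or_gt (e * r) (3 * (1 - (1 - e) / 2)) with h | h
    · have h1 : 2 ≤ e * g * (r' - r) := by
        nlinarith [mul_nonneg (sub_nonneg.2 hg) (sub_nonneg.2 h)]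
      have h2 : e * g * (e * q * η / 4) ≤ e * (e ^ 2 * q) * (q * η) / 8 := by
        have : 0 ≤ e * (e * q * η / 4) := by positivity
        nlinarith [mul_le_mul_of_nonneg_left hg2 this]
      have h3 : e * (e ^ 2 * q) * (q * η) ≤ 1 * 16 * 1 := by gcongr
      linarith
    · have h1 := mul_le_mul_of_nonneg_right hgr (sub_nonneg.2 h.le)
      have h2 : e * (q ^ 2 * η / 8) ≤ (1 + (1 - e) / 2) * (e * g * (r' - r)) := by
        have h3 := mul_le_mul_of_nonneg_left (hP hq4) he0.le
        have h4 := mul_le_mul_of_nonneg_left hr' (by linarith : 0 ≤ 1 + (1 - e) / 2)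
        have h5 : 0 ≤ e * (r - (1 + q * e / 4)) ^ 2 := by positivity
        nlinarith
      have h3 : (1 + (1 - e) / 2) * (e * g * (e * q * η / 4)) ≤ e * (q ^ 2 * η / 8) := by
        have h4 : 0 ≤ e * (e * q * η / 4) := by positivity
        have h5 : e ^ 2 ≤ 1 := by nlinarith
        have h6 : 0 ≤ e * (q ^ 2 * η / 8) := by positivity
        nlinarith [mul_le_mul_of_nonneg_left hg1 h4, mul_le_mul_of_nonneg_left h5 h6]
      exact le_of_mul_le_mul_left (h3.trans h2) (by linarith)
  exact le_of_mul_le_mul_left key heg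

lemma length_le_of_isDoublingMin {a D q η x : ℝ} {f : ℝ → ℝ}
    (hf : LipschitzOnWith 1 f (Icc 0 a)) (hbd : ∀ w ∈ Icc (0 : ℝ) a, D * w ≤ f w)
    (hD0 : 0 ≤ D) (hD : D < 1 / 2) (hq0 : 0 < q) (hη0 : 0 < η) (hqη : q * η ≤ 1)
    (hDq : (1 - 2 * D) ^ 2 * q ≤ 16)
    (hP : 4 ≤ q → q ^ 2 * η / 8 ≤ q * (2 - D) / 2 - 1 - q ^ 2 * (1 - 2 * D) ^ 2 / 16)
    (hx : 0 < x) (hC : ∀ u ∈ Icc x a, u ≤ q * drop u f) {y B : ℝ} (hxy : x ≤ y) (hya : y ≤ a)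
    (hmin : IsDoublingMin a f y) (hB : drop y f ≤ B) (hB0 : 0 < B) (hz : 2 * B ≤ y - f y) :
    a ≤ q * B ∨ 4 ≤ q ∧ (y - f y) / B ≤ q * (1 - 2 * D) / 2 ∧ a ≤ q ^ 2 * B *
      q ^ ((q * (1 - 2 * D) / 2 - (y - f y) / B) / ((1 - 2 * D) * q * η / 4)) := by
  obtain ⟨n, hn⟩ : ∃ n : ℕ, a ≤ 2 ^ n * y := by
    obtain ⟨n, hn⟩ := pow_unbounded_of_one_lt (a / y) (one_lt_two (α := ℝ))
    exact ⟨n, ((div_lt_iff₀ (hx.trans_le hxy)).1 hn).le⟩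
  have hterm : ∀ {B : ℝ}, drop a f ≤ B → a ≤ q * B := fun h =>
    (hC a ⟨hxy.trans hya, le_rfl⟩).trans (mul_le_mul_of_nonneg_left h hq0.le)
  induction n generalizing y B with
  | zero =>
    left
    rw [show a = y by linarith]
    exact (hC y ⟨hxy, hya⟩).trans (mul_le_mul_of_nonneg_left hB hq0.le)
  | succ n ih =>
    have hy : 0 < y := hx.trans_le hxy
    rcases drop_le_or_exists hf hy hya hmin hB with h | ⟨U, hyU, hUa, hUB, hfU⟩
    · exact .inl (hterm h)
    obtain ⟨y', hUy', hya', hmin', hle, hd⟩ := exists_isDoublingMin hf (by linarith) hUa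
    have hUq : U ≤ q * B :=
      (hC U ⟨by linarith, hUa⟩).trans (mul_le_mul_of_nonneg_left hUB hq0.le)
    have hlip := (sub_le_of_lipschitzOn hf (by linarith) hUy' hya').1
    have hDy' := hbd y' ⟨by linarith, hya'⟩
    set B' := B + (f U - f y') with hB'
    have hBB' : B ≤ B' := by linarith
    have hB'0 : 0 < B' := by linarith
    have hz' : 2 * B' ≤ y' - f y' := by linarith
    have hgr : (1 + D) * (B' / B - 1) ≤ q * (1 - 2 * D) / 2 - (y - f y) / B := by
      have : (1 + D) * (B' - B) ≤ (q * B) * (1 - 2 * D) / 2 - (y - f y) := by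
        nlinarith [mul_le_mul_of_nonneg_left (show U + f U - f y' ≤ y' by linarith) hD0]
      calc _ = ((1 + D) * (B' - B)) / B := by field_simp
        _ ≤ ((q * B) * (1 - 2 * D) / 2 - (y - f y)) / B := by gcongr
        _ = _ := by field_simp
    have hr' : (1 - D) * (3 * (B' / B) - 3 + 2 * ((y - f y) / B)) ≤
        (1 - 2 * D) * ((y' - f y') / B' * (B' / B)) := by
      have : (1 - D) * (3 * B' - 3 * B + 2 * (y - f y)) ≤ (1 - 2 * D) * (y' - f y') := by
        nlinarith
      calc _ = ((1 - D) * (3 * B' - 3 * B + 2 * (y - f y))) / B := by field_simp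
        _ ≤ ((1 - 2 * D) * (y' - f y')) / B := by gcongr
        _ = _ := by field_simp
    have hg : 1 ≤ B' / B := (one_le_div hB0).2 hBB'
    obtain ⟨hq4, hgq, hinc⟩ := increment_of_step hD0 hD hq0 hη0 hqη hDq hP
      ((le_div_iff₀ hB0).2 hz) hg hgr hr'
    have hR : (y - f y) / B ≤ q * (1 - 2 * D) / 2 := by nlinarith
    refine .inr ⟨hq4, hR, ?_⟩
    have hB'q : B' ≤ q * B := (div_le_iff₀ hB0).1 hgq
    have hτ : 0 < (1 - 2 * D) * q * η / 4 := by
      have : 0 < 1 - 2 * D := by linarith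
      positivity
    have hq1 : 1 ≤ q := by linarith
    rcases ih (hxy.trans (by linarith)) hya' hmin' (by linarith) hB'0 hz'
      (by rw [pow_succ] at hn
          nlinarith [mul_le_mul_of_nonneg_left (hyU.trans hUy') (pow_pos two_pos n).le]) with
      h | ⟨-, -, h⟩
    · calc a ≤ q * B' := h
        _ ≤ q * (q * B) := by gcongr
        _ = q ^ 2 * B * 1 := by ring
        _ ≤ _ := by
          gcongr
          exact Real.one_le_rpow hq1 (div_nonneg (sub_nonneg.2 hR) hτ.le)
    · calc a ≤ _ := h
        _ ≤ q ^ 2 * (q * B) *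
            q ^ ((q * (1 - 2 * D) / 2 - (y - f y) / B) / ((1 - 2 * D) * q * η / 4) - 1) := by
          gcongr
          rw [le_sub_iff_add_le, ← le_sub_iff_add_le', ← sub_div, one_le_div hτ]
          linarith
        _ = _ := by
          rw [Real.rpow_sub_one hq0.ne']
          field_simp

lemma length_le_of_le_mul_drop {a D q η x : ℝ} {f : ℝ → ℝ}
    (hf : LipschitzOnWith 1 f (Icc 0 a)) (h0 : f 0 = 0)
    (hbd : ∀ w ∈ Icc (0 : ℝ) a, D * w ≤ f w)
    (hD0 : 0 ≤ D) (hD : D < 1 / 2) (hq0 : 0 < q) (hη0 : 0 < η) (hqη : q * η ≤ 1)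
    (hDq : (1 - 2 * D) ^ 2 * q ≤ 16)
    (hP : 4 ≤ q → q ^ 2 * η / 8 ≤ q * (2 - D) / 2 - 1 - q ^ 2 * (1 - 2 * D) ^ 2 / 16)
    (hx : 0 < x) (hxa : x ≤ a) (hC : ∀ u ∈ Icc x a, u ≤ q * drop u f) :
    a ≤ q * x ∨ a ≤ q ^ 2 * x * q ^ (2 / η) := by
  obtain ⟨y, hxy, hya, hmin, hle, hd⟩ := exists_isDoublingMin hf hx hxa
  have hhalf := drop_le_half hf h0 hx hxa
  have hlip := (sub_le_of_lipschitzOn hf hx.le hxy hya).1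
  have hfx := (sub_le_of_lipschitzOn hf le_rfl hx.le hxa).2
  have hfy : 0 ≤ f y := (mul_nonneg hD0 (hx.le.trans hxy)).trans (hbd y ⟨hx.le.trans hxy, hya⟩)
  set B := (x + f x - 2 * f y) / 2 with hB
  have hyB : drop y f ≤ B := by linarith
  have hB0 : 0 < B := by
    have := hC y ⟨hxy, hya⟩
    have : 0 < drop y f := by
      by_contra! h
      nlinarith
    linarith
  have hBx : B ≤ x := by linarith
  rcases length_le_of_isDoublingMin hf hbd hD0 hD hq0 hη0 hqη hDq hP hx hC hxy hya hmin hyB hB0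
    (by linarith) with h | ⟨hq4, -, h⟩
  · exact .inl (h.trans (by gcongr))
  · refine .inr (h.trans ?_)
    have he : 0 < 1 - 2 * D := by linarith
    have hr : 0 ≤ (y - f y) / B := div_nonneg (by linarith) hB0.le
    have hexp : (q * (1 - 2 * D) / 2 - (y - f y) / B) / ((1 - 2 * D) * q * η / 4) ≤ 2 / η := by
      rw [div_le_div_iff₀ (by positivity) hη0]
      nlinarith [mul_nonneg hr hη0.le]
    have hq1 : 1 ≤ q := by linarith
    gcongr

lemma six_mul_le {δ : ℝ} (hδ : δ ∈ Ioo (0 : ℝ) (1 / 2)) :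
    6 * δ ≤ δ * (2 - 4 * Real.logb 2 δ) := by
  have hℓ : Real.logb 2 δ ≤ -1 := by
    rw [Real.logb_le_iff_le_rpow one_lt_two hδ.1, Real.rpow_neg_one]
    linarith [hδ.2]
  nlinarith [hδ.1]

lemma three_mul_rpow_lt_one {δ q : ℝ} (hδ : δ ∈ Ioo (0 : ℝ) (1 / 2)) (hq0 : 0 < q)
    (hqη : q * (δ * (2 - 4 * Real.logb 2 δ)) ≤ 1) :
    3 * q * 2 ^ (-(1 / δ)) * q ^ (2 / (δ * (2 - 4 * Real.logb 2 δ))) < 1 := by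
  have hη6 := six_mul_le hδ
  obtain ⟨hδ0, hδ1⟩ := hδ
  set η := δ * (2 - 4 * Real.logb 2 δ) with hη
  have hη0 : 0 < η := by linarith
  have hδq : 6 * δ * q ≤ 1 := by nlinarith
  have h3q : 3 * q < 2 ^ (1 / (2 * δ)) := by
    have hX : 1 ≤ 1 / (2 * δ) := by rw [le_div_iff₀ (by positivity)]; linarith
    have h3 := one_add_mul_self_le_rpow_one_add (by norm_num : (-1 : ℝ) ≤ 1) hX
    have h4 : 3 * q ≤ 1 / (2 * δ) := by rw [le_div_iff₀ (by positivity)]; linarith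
    norm_num at h3 h4 ⊢
    linarith
  have hqpow : q ^ (2 / η) < 2 ^ (1 / (2 * δ)) := by
    have hqδ : q ≤ 1 / δ := by rw [le_div_iff₀ hδ0]; nlinarith
    calc q ^ (2 / η) ≤ (1 / δ) ^ (2 / η) := by gcongr
      _ = 2 ^ (-Real.logb 2 δ * (2 / η)) := by
        rw [Real.rpow_mul two_pos.le, Real.rpow_neg two_pos.le,
          Real.rpow_logb two_pos (by norm_num) hδ0, one_div]
      _ < _ := by
        refine Real.rpow_lt_rpow_of_exponent_lt one_lt_two ?_
        rw [mul_div_assoc', div_lt_div_iff₀ hη0 (by positivity)]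
        nlinarith
  calc _ < (2 : ℝ) ^ (1 / (2 * δ)) * 2 ^ (-(1 / δ)) * 2 ^ (1 / (2 * δ)) := by gcongr
    _ = 1 := by
      rw [← Real.rpow_add two_pos, ← Real.rpow_add two_pos,
        show 1 / (2 * δ) + -(1 / δ) + 1 / (2 * δ) = 0 by field_simp; ring, Real.rpow_zero]

/-- **Proposition (small drop on initial segments).** Let `a > 0`, `0 ≤ D < 1/2`, and let
`f : [0,a] → ℝ` be `1`-Lipschitz, piecewise linear on every closed subinterval of `(0,a]`,
with `f(0) = 0` and `f(x) ≥ Dx`. Let `Φ(D) = (2 − D − √(3 − 3D²))/4`. Then for every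
`δ ∈ (0,1/2)` there is `u ∈ [3aΦ(D)2^{-1/δ}, a]` with
`T(f|[0,u]) < u(Φ(D) + δ(2 − 4log₂δ))`. -/
theorem statement14 (a D : ℝ) (ha : 0 < a) (hD0 : 0 ≤ D) (hD : D < 1 / 2)
    (f : ℝ → ℝ) (hf : LipschitzOnWith 1 f (Set.Icc 0 a))
    (hpl : ∀ c b : ℝ, 0 < c → c ≤ b → b ≤ a → PiecewiseLinearOn f c b)
    (h0 : f 0 = 0) (hbd : ∀ x ∈ Set.Icc (0 : ℝ) a, D * x ≤ f x)
    (δ : ℝ) (hδ : δ ∈ Set.Ioo (0 : ℝ) (1 / 2)) :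
    ∃ u ∈ Set.Icc (3 * a * ((2 - D - Real.sqrt (3 - 3 * D ^ 2)) / 4) * (2 : ℝ) ^ (-(1 / δ))) a,
      drop u f <
        u * ((2 - D - Real.sqrt (3 - 3 * D ^ 2)) / 4 + δ * (2 - 4 * Real.logb 2 δ)) := by
  set Φ := (2 - D - Real.sqrt (3 - 3 * D ^ 2)) / 4 with hΦ
  have hδ0 := hδ.1
  set η := δ * (2 - 4 * Real.logb 2 δ)
  have hη0 : 0 < η := by linarith [six_mul_le hδ]
  have hs := Real.sqrt_nonneg (3 - 3 * D ^ 2)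
  have hs2 := Real.sq_sqrt (by nlinarith : 0 ≤ 3 - 3 * D ^ 2)
  set s := Real.sqrt (3 - 3 * D ^ 2)
  have hsD : s < 2 - D := lt_of_pow_lt_pow_left₀ 2 (by linarith) (by nlinarith)
  have hΦ0 : 0 < Φ := by rw [hΦ]; linarith
  have hΦ1 : Φ ≤ 1 / 2 := by rw [hΦ]; linarith
  have hprod : Φ * (1 - D / 2 - Φ) = (1 - 2 * D) ^ 2 / 16 := by rw [hΦ]; linarith
  have h2δ : (2 : ℝ) ^ (-(1 / δ)) ≤ 1 / 4 := by
    rw [show (1 / 4 : ℝ) = 2 ^ (-2 : ℝ) by norm_num [Real.rpow_neg]]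
    gcongr
    · norm_num
    · rw [le_div_iff₀ hδ0]; linarith [hδ.2]
  have h2δ0 : (0 : ℝ) < 2 ^ (-(1 / δ)) := by positivity
  set x := 3 * a * Φ * (2 : ℝ) ^ (-(1 / δ)) with hx
  have hx0 : 0 < x := by positivity
  have hxa : x ≤ a := by
    have : x ≤ 3 * a * (1 / 2) * (1 / 4) := by rw [hx]; gcongr
    linarith
  by_contra! hcon
  set q := 1 / (Φ + η) with hq
  have hq0 : 0 < q := by positivity
  have hqc : q * (Φ + η) = 1 := by rw [hq]; field_simp
  have hqΦ : q * Φ ≤ 1 := by nlinarith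
  have hqη : q * η ≤ 1 := by nlinarith
  have hC : ∀ u ∈ Icc x a, u ≤ q * drop u f := fun u hu => by
    have := mul_le_mul_of_nonneg_left (hcon u hu) hq0.le
    linear_combination this - u * hqc
  have hDq : (1 - 2 * D) ^ 2 * q ≤ 16 := by
    have : (1 - 2 * D) ^ 2 * q = 16 * (q * Φ) * (1 - D / 2 - Φ) := by
      linear_combination -16 * q * hprod
    rw [this]
    have h1 : q * Φ * (1 - D / 2 - Φ) ≤ 1 * 1 := by
      gcongr
      · rw [hΦ]; linarith
      · linarith
    linarith
  have hP : 4 ≤ q → q ^ 2 * η / 8 ≤ q * (2 - D) / 2 - 1 - q ^ 2 * (1 - 2 * D) ^ 2 / 16 := by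
    intro hq4
    have hc : Φ + η ≤ 1 / 4 := by
      linarith [mul_le_mul_of_nonneg_right hq4 (add_pos hΦ0 hη0).le]
    have : q * (2 - D) / 2 - 1 - q ^ 2 * (1 - 2 * D) ^ 2 / 16 =
        q ^ 2 * (η * ((1 - D / 2 - Φ) - (Φ + η))) := by
      linear_combination q ^ 2 * hprod - (q * (1 - D / 2) - 1 - q * (Φ + η)) * hqc
    rw [this]
    have h1 : 1 / 8 ≤ (1 - D / 2 - Φ) - (Φ + η) := by
      have : Φ ≤ (2 - D) / 4 := by rw [hΦ]; linarith
      linarith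
    calc q ^ 2 * η / 8 = q ^ 2 * (η * (1 / 8)) := by ring
      _ ≤ _ := by gcongr
  rcases length_le_of_le_mul_drop hf h0 hbd hD0 hD hq0 hη0 hqη hDq hP hx0 hxa hC with h | h
  · have : q * x ≤ 3 * a * 1 * (1 / 4) := by
      calc q * x = 3 * a * (q * Φ) * 2 ^ (-(1 / δ)) := by rw [hx]; ring
        _ ≤ _ := by gcongr
    linarith
  · have h1 : a ≤ a * (3 * q * 2 ^ (-(1 / δ)) * q ^ (2 / η)) := by
      calc a ≤ _ := h
        _ = a * (3 * q * 2 ^ (-(1 / δ)) * q ^ (2 / η)) * (q * Φ) := by rw [hx]; ring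
        _ ≤ a * (3 * q * 2 ^ (-(1 / δ)) * q ^ (2 / η)) * 1 := by gcongr
        _ = _ := mul_one _
    have h2 : 1 ≤ 3 * q * 2 ^ (-(1 / δ)) * q ^ (2 / η) :=
      le_of_mul_le_mul_left (by linarith) ha
    exact absurd h2 (not_le.2 (three_mul_rpow_lt_one hδ hq0 hqη))
end

section
/- Let D ∈ [0,1/3) and Λ(D) = (1+D)(37 − 50D + 60D²)/(18(3 − 4D + 5D²)); note Λ(D) ≥ Λ(0) = 37/54. Then there exist η > 0 and ξ ∈ (2/3, 1] such that Λ(D) = ξ(1 − 2η) and the following holds: for every 1-Lipschitz function f : [0,1] → ℝ with f(0) = 0 and f(x) ≥ Dx on [0,1], if T(f) > 1 − Λ(D) then f(x) ≥ x/3 − ηξ for all x ∈ [0, ξ]. -/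
open Set

/-- The properties of the function `x ↦ drop x f` that are used to estimate it, for a
`1`-Lipschitz function `f` on `[0,1]` vanishing at `0`. -/
structure IsDropLike (f τ : ℝ → ℝ) : Prop where
  map_zero : f 0 = 0
  lip : ∀ x y, 0 ≤ x → x ≤ y → y ≤ 1 → f x - f y ≤ y - x ∧ f y - f x ≤ y - x
  cont : ContinuousOn f (Icc 0 1)
  le_self : ∀ x, 0 < x → x ≤ 1 → τ x ≤ x
  mono : ∀ c a, 0 < c → c ≤ a → a ≤ 1 → τ c ≤ τ a
  step : ∀ c a m, 0 < c → c ≤ a → a ≤ 2 * c → a ≤ 1 → (∀ x ∈ Icc c a, m ≤ f x) →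
    τ a ≤ f c - m + τ c

namespace IsDropLike

variable {f τ : ℝ → ℝ}

theorem le_id (h : IsDropLike f τ) {x : ℝ} (hx : 0 ≤ x) (hx1 : x ≤ 1) : f x ≤ x := by
  have := (h.lip 0 x le_rfl hx hx1).2
  rw [h.map_zero] at this
  linarith

theorem contOn (h : IsDropLike f τ) {b c : ℝ} (hb : 0 ≤ b) (hc : c ≤ 1) :
    ContinuousOn f (Icc b c) :=
  h.cont.mono (Icc_subset_Icc hb hc)

theorem le_add_sub (h : IsDropLike f τ) {c a : ℝ} (hc : 0 < c) (hca : c ≤ a) (ha : a ≤ 1) :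
    τ a ≤ τ c + (a - c) := by
  have key : ∀ n : ℕ, ∀ a, c ≤ a → a ≤ 1 → a ≤ 2 ^ n * c → τ a ≤ τ c + (a - c) := by
    have short : ∀ c a, 0 < c → c ≤ a → a ≤ 1 → a ≤ 2 * c → τ a ≤ τ c + (a - c) := by
      intro c a hc hca ha h2
      have := h.step c a (f c - (a - c)) hc hca h2 ha (by
        intro x hx
        have := (h.lip c x hc.le hx.1 (hx.2.trans ha)).1
        linarith [hx.2])
      linarith
    intro n
    induction n with
    | zero =>
      intro a hca _ h1
      have : a = c := le_antisymm (by simpa using h1) hca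
      subst this; simp
    | succ n ih =>
      intro a hca ha h1
      rcases le_total a (2 * c) with h2 | h2
      · exact short c a hc hca ha h2
      · have e1 := ih (a / 2) (by linarith) (by linarith) (by rw [pow_succ] at h1; linarith)
        have e2 := short (a / 2) a (by linarith) (by linarith) ha (by linarith)
        linarith
  obtain ⟨n, hn⟩ := pow_unbounded_of_one_lt (a / c) (one_lt_two)
  exact key n a hca ha ((div_le_iff₀ hc).1 hn.le)

theorem continuousOn_drop (h : IsDropLike f τ) {ε : ℝ} (hε : 0 < ε) :
    ContinuousOn τ (Icc ε 1) := by
  have : LipschitzOnWith 1 τ (Icc ε 1) := by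
    refine LipschitzOnWith.of_dist_le_mul fun x hx y hy => ?_
    simp only [NNReal.coe_one, one_mul, Real.dist_eq]
    rcases le_total x y with hxy | hxy
    · have e1 := h.mono x y (hε.trans_le hx.1) hxy hy.2
      have e2 := h.le_add_sub (hε.trans_le hx.1) hxy hy.2
      rw [abs_of_nonpos (by linarith), abs_of_nonpos (by linarith)]
      linarith
    · have e1 := h.mono y x (hε.trans_le hy.1) hxy hx.2
      have e2 := h.le_add_sub (hε.trans_le hy.1) hxy hx.2
      rw [abs_of_nonneg (by linarith), abs_of_nonneg (by linarith)]
      linarith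
  exact this.continuousOn

/-- If every pair `p ≤ q` of points of `[b,c]` at the same height has ratio at most `2`, and `c` is
the lowest point of `[b,c]`, one can go from `c` to `b` through points of increasing height. -/
theorem le_of_gap (h : IsDropLike f τ) {b c : ℝ} (hb : 0 < b) (hbc : b ≤ c) (hc : c ≤ 1)
    (hmin : ∀ x ∈ Icc b c, f c ≤ f x)
    (hgap : ∀ p q, b ≤ p → p ≤ q → q ≤ c → f p = f q → q ≤ 2 * p) :
    τ c ≤ f b - f c + τ b := by
  have key : ∀ n : ℕ, ∀ a, b ≤ a → a ≤ c → a ≤ 2 ^ n * b → (∀ x ∈ Icc b a, f a ≤ f x) →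
      τ a ≤ f b - f a + τ b := by
    intro n
    induction n with
    | zero =>
      intro a hba _ h1 _
      have : a = b := le_antisymm (by simpa using h1) hba
      subst this; simp
    | succ n ih =>
      intro a hba hac h1 hm
      rcases le_total a (2 * b) with h2 | h2
      · exact h.step b a (f a) hb hba h2 (hac.trans hc) hm
      · have hb2 : b ≤ a / 2 := by linarith
        obtain ⟨p, hp, hpmin⟩ := isCompact_Icc.exists_isMinOn (nonempty_Icc.2 hb2)
          (h.contOn hb.le (by linarith : a / 2 ≤ 1))
        have hpmin' : ∀ x ∈ Icc b (a / 2), f p ≤ f x := fun x hx => hpmin hx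
        have hcont : ContinuousOn f (Icc (a / 2) a) := h.contOn (by linarith) (by linarith)
        have hK : IsCompact (Icc (a / 2) a ∩ f ⁻¹' Iic (f p)) :=
          isCompact_Icc.of_isClosed_subset
            (hcont.preimage_isClosed_of_isClosed isClosed_Icc isClosed_Iic) inter_subset_left
        obtain ⟨q, ⟨hq, hqp⟩, hqleast⟩ := hK.exists_isLeast
          ⟨a, ⟨by linarith, le_rfl⟩, hm p ⟨hp.1, by linarith [hp.2]⟩⟩
        have hqp : f q ≤ f p := hqp
        have hfq : f q = f p := by
          obtain ⟨z, hz, hfz⟩ := intermediate_value_Icc' hq.1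
            (hcont.mono (Icc_subset_Icc le_rfl hq.2))
            ⟨hqp, hpmin' (a / 2) ⟨hb2, le_rfl⟩⟩
          have : q ≤ z := hqleast ⟨⟨hz.1, hz.2.trans hq.2⟩, hfz.le⟩
          rw [le_antisymm this hz.2, hfz]
        have hpq : p ≤ q := hp.2.trans hq.1
        have e1 := h.step q a (f a) (by linarith [hq.1]) hq.2 (by linarith [hq.1]) (hac.trans hc)
          fun x hx => hm x ⟨by linarith [hx.1, hq.1], hx.2⟩
        have e2 := h.step p q (f p) (by linarith [hp.1]) hpq
          (hgap p q hp.1 hpq (hq.2.trans hac) hfq.symm) (by linarith [hq.2]) fun x hx => by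
            rcases le_total x (a / 2) with hxa | hxa
            · exact hpmin' x ⟨hp.1.trans hx.1, hxa⟩
            · by_contra! hlt
              have : q ≤ x := hqleast ⟨⟨hxa, hx.2.trans hq.2⟩, hlt.le⟩
              have : x = q := le_antisymm hx.2 this
              rw [this, hfq] at hlt
              exact lt_irrefl _ hlt
        have e3 := ih p hp.1 (by linarith [hp.2]) (by rw [pow_succ] at h1; linarith [hp.2])
          fun x hx => hpmin' x ⟨hx.1, hx.2.trans hp.2⟩
        linarith
  obtain ⟨n, hn⟩ := pow_unbounded_of_one_lt (c / b) (one_lt_two)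
  exact key n c hbc le_rfl ((div_le_iff₀ hb).1 hn.le) hmin

theorem min_of_gap (h : IsDropLike f τ) {b c : ℝ} (hb : 0 < b) (hc : c ≤ 1)
    (hstuck : ∀ x ∈ Ico (c / 2) c, f c < f x)
    (hgap : ∀ p q, b ≤ p → p ≤ q → q ≤ c → f p = f q → q ≤ 2 * p) :
    ∀ x ∈ Icc b c, f c ≤ f x := by
  intro x hx
  have hc0 : 0 < c := hb.trans_le (hx.1.trans hx.2)
  rcases eq_or_lt_of_le hx.2 with rfl | hxc
  · exact le_rfl
  by_contra! hlt
  rcases le_total (c / 2) x with h2 | h2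
  · exact absurd (hstuck x ⟨h2, hxc⟩) hlt.not_gt
  have hc2 := hstuck (c / 2) ⟨le_rfl, by linarith⟩
  obtain ⟨p, hp, hfp⟩ := intermediate_value_Icc h2
    (h.contOn (hb.le.trans hx.1) (by linarith)) ⟨hlt.le, hc2.le⟩
  have := hgap p c (hx.1.trans hp.1) (by linarith [hp.2]) le_rfl hfp
  have : p = c / 2 := by linarith [hp.2]
  rw [← this] at hc2
  linarith

/-- The last point of `[l,c']` where `f x + ρ x ≤ L`, under which there are no large gaps. -/
theorem exists_last (h : IsDropLike f τ) {ρ l c' c S Φ L : ℝ} (hρ : 0 < ρ) (hρ2 : ρ < 2)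
    (hl : 0 ≤ l) (hlc : l ≤ c') (hcc : c' ≤ c) (hc : c ≤ 1) (hL : 0 < L)
    (hS : ∀ x ∈ Icc l c, f x ≤ S - x) (hΦ : ∀ x ∈ Icc l c, f x ≤ x - Φ)
    (hLS : (1 + ρ) * S ≤ 3 * L + (2 - ρ) * Φ)
    (h1 : f l + ρ * l ≤ L) (h2 : L < f c' + ρ * c') (h3 : ∀ x ∈ Icc c' c, L ≤ f x + ρ * x) :
    ∃ b, 0 < b ∧ l ≤ b ∧ b ≤ c' ∧ f b + ρ * b = L ∧
      ∀ p q, b ≤ p → p ≤ q → q ≤ c → f p = f q → q ≤ 2 * p := by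
  have hcont : ContinuousOn (fun x => f x + ρ * x) (Icc l c') :=
    (h.contOn hl (hcc.trans hc)).add (by fun_prop)
  have hK : IsCompact (Icc l c' ∩ (fun x => f x + ρ * x) ⁻¹' Iic L) :=
    isCompact_Icc.of_isClosed_subset
      (hcont.preimage_isClosed_of_isClosed isClosed_Icc isClosed_Iic) inter_subset_left
  obtain ⟨b, ⟨hb, hbL⟩, hbg⟩ := hK.exists_isGreatest ⟨l, ⟨le_rfl, hlc⟩, h1⟩
  have hbL : f b + ρ * b ≤ L := hbL
  have hbe : f b + ρ * b = L := by
    obtain ⟨z, hz, hfz⟩ := intermediate_value_Icc hb.2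
      (hcont.mono (Icc_subset_Icc hb.1 le_rfl)) ⟨hbL, h2.le⟩
    have hfz : f z + ρ * z = L := hfz
    have : z ≤ b := hbg ⟨⟨hb.1.trans hz.1, hz.2⟩, hfz.le⟩
    rw [le_antisymm hz.1 this, hfz]
  have hge : ∀ p, b ≤ p → p ≤ c → L ≤ f p + ρ * p := by
    intro p hbp hpc
    rcases le_total c' p with h4 | h4
    · exact h3 p ⟨h4, hpc⟩
    · by_contra! hlt
      have : p ≤ b := hbg ⟨⟨hb.1.trans hbp, h4⟩, hlt.le⟩
      rw [le_antisymm this hbp] at hlt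
      linarith
  refine ⟨b, ?_, hb.1, hb.2, hbe, ?_⟩
  · rcases eq_or_lt_of_le (hl.trans hb.1) with h0 | h0
    · rw [← h0, h.map_zero] at hbe
      linarith
    · exact h0
  · intro p q hbp hpq hqc hpe
    have e1 := hge p hbp (hpq.trans hqc)
    have e2 := hS q ⟨hb.1.trans (hbp.trans hpq), hqc⟩
    have e3 := hΦ p ⟨hb.1.trans hbp, hpq.trans hqc⟩
    have e4 : q ≤ S - L + ρ * p := by linarith
    have e5 : L + Φ ≤ (1 + ρ) * p := by linarith
    have e6 : (2 - ρ) * (L + Φ) ≤ (2 - ρ) * ((1 + ρ) * p) :=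
      mul_le_mul_of_nonneg_left e5 (by linarith)
    have e7 : (1 + ρ) * q ≤ (1 + ρ) * (S - L + ρ * p) :=
      mul_le_mul_of_nonneg_left e4 (by linarith)
    nlinarith

theorem exists_min_of_not_stuck (h : IsDropLike f τ) {a : ℝ} (ha : 0 < a) (ha1 : a ≤ 1)
    (hns : ∃ c ∈ Ico (a / 2) a, f c ≤ f a) :
    ∃ m ∈ Ico (a / 2) a, f m ≤ f a ∧ τ a ≤ τ m := by
  obtain ⟨c, hc, hca⟩ := hns
  obtain ⟨p, hp, hpmin⟩ := isCompact_Icc.exists_isMinOn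
    (nonempty_Icc.2 (by linarith : a / 2 ≤ a)) (h.contOn (by linarith) ha1)
  have hpmin' : ∀ x ∈ Icc (a / 2) a, f p ≤ f x := fun x hx => hpmin hx
  have key : ∀ m ∈ Ico (a / 2) a, f m ≤ f p → f m ≤ f a ∧ τ a ≤ τ m := by
    intro m hm hmp
    refine ⟨hmp.trans (hpmin' a ⟨by linarith, le_rfl⟩), ?_⟩
    have := h.step m a (f m) (by linarith [hm.1]) hm.2.le (by linarith [hm.1]) ha1
      fun x hx => hmp.trans (hpmin' x ⟨hm.1.trans hx.1, hx.2⟩)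
    linarith
  rcases eq_or_lt_of_le hp.2 with rfl | hpa
  · exact ⟨c, hc, key c hc hca⟩
  · exact ⟨p, ⟨hp.1, hpa⟩, key p ⟨hp.1, hpa⟩ le_rfl⟩

theorem exists_descent (h : IsDropLike f τ) {ρ a : ℝ} (hρ : 0 < ρ) (hρ2 : ρ < 2)
    (ha : 0 < a) (ha1 : a ≤ 1) (h0 : 0 ≤ f a) (hlow : (1 - 2 * ρ) * a ≤ (2 - ρ) * f a) :
    ∃ m, 0 < m ∧ m < a ∧
      (1 + ρ) * τ a - ρ * (a - f a) ≤ (1 + ρ) * τ m - ρ * (m - f m) := by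
  by_cases hns : ∃ c ∈ Ico (a / 2) a, f c ≤ f a
  · obtain ⟨m, hm, -, hτ⟩ := h.exists_min_of_not_stuck ha ha1 hns
    refine ⟨m, by linarith [hm.1], hm.2, ?_⟩
    have := (h.lip m a (by linarith [hm.1]) hm.2.le ha1).2
    nlinarith
  push Not at hns
  have fin : ∀ m, 0 < m → m < a → f m + ρ * m ≤ f a + ρ * a → τ a ≤ f m - f a + τ m →
      ∃ m, 0 < m ∧ m < a ∧
      (1 + ρ) * τ a - ρ * (a - f a) ≤ (1 + ρ) * τ m - ρ * (m - f m) := by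
    intro m hm hma hg hτ
    refine ⟨m, hm, hma, ?_⟩
    nlinarith
  by_cases hone : ∃ c ∈ Ico (a / 2) a, f c + ρ * c ≤ f a + ρ * a
  · obtain ⟨c, hc, hg⟩ := hone
    refine fin c (by linarith [hc.1]) hc.2 hg ?_
    refine h.step c a (f a) (by linarith [hc.1]) hc.2.le (by linarith [hc.1]) ha1 fun x hx => ?_
    rcases eq_or_lt_of_le hx.2 with rfl | hxa
    · exact le_rfl
    · exact (hns x ⟨hc.1.trans hx.1, hxa⟩).le
  push Not at hone
  have hL : 0 < f a + ρ * a := by positivity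
  obtain ⟨b, hb, -, hba, hbe, hgap⟩ := h.exists_last (l := 0) (c' := a / 2) (c := a)
    (S := f a + a) (Φ := 0) (L := f a + ρ * a) hρ hρ2 le_rfl (by linarith) (by linarith) ha1 hL
    (fun x hx => by have := (h.lip x a hx.1 hx.2 ha1).1; linarith)
    (fun x hx => by have := h.le_id hx.1 (hx.2.trans ha1); linarith)
    (by nlinarith) (by rw [h.map_zero]; linarith)
    (hone _ ⟨le_rfl, by linarith⟩)
    (fun x hx => by
      rcases eq_or_lt_of_le hx.2 with rfl | hxa
      · exact le_rfl
      · exact (hone x ⟨hx.1, hxa⟩).le)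
  exact fin b hb (by linarith) hbe.le
    (h.le_of_gap hb (by linarith) ha1 (h.min_of_gap hb ha1 hns hgap) hgap)

/-- The general bound for the drop on `[0,a]`. -/
theorem drop_le (h : IsDropLike f τ) {ρ : ℝ} (hρ : 0 < ρ) (hρ2 : ρ < 2)
    (h0 : ∀ x, 0 ≤ x → x ≤ 1 → 0 ≤ f x)
    (hlow : ∀ x, 0 ≤ x → x ≤ 1 → (1 - 2 * ρ) * x ≤ (2 - ρ) * f x)
    {a : ℝ} (ha : 0 < a) (ha1 : a ≤ 1) : (1 + ρ) * τ a ≤ ρ * (a - f a) := by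
  by_contra! hlt
  set G : ℝ → ℝ := fun x => (1 + ρ) * τ x - ρ * (x - f x) with hG
  have hε : 0 < G a := by simp only [hG]; linarith
  set e := G a / (1 + ρ) with he
  have hepos : 0 < e := by positivity
  have hmem : ∀ x, 0 < x → x ≤ 1 → G a ≤ G x → e ≤ x := by
    intro x hx hx1 hgx
    rw [he, div_le_iff₀ (by linarith)]
    have e1 := h.le_self x hx hx1
    have e2 := h.le_id hx.le hx1
    have : G x ≤ (1 + ρ) * x := by
      simp only [hG]
      nlinarith
    linarith
  have hcont : ContinuousOn G (Icc e 1) := by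
    have c1 := h.continuousOn_drop hepos
    have c2 := h.contOn hepos.le le_rfl
    exact (continuousOn_const.mul c1).sub (continuousOn_const.mul (continuousOn_id.sub c2))
  have hK : IsCompact (Icc e 1 ∩ G ⁻¹' Ici (G a)) :=
    isCompact_Icc.of_isClosed_subset
      (hcont.preimage_isClosed_of_isClosed isClosed_Icc isClosed_Ici) inter_subset_left
  obtain ⟨q, ⟨hq, hqG⟩, hql⟩ := hK.exists_isLeast
    ⟨a, ⟨hmem a ha ha1 le_rfl, ha1⟩, le_refl (G a)⟩
  have hq0 : 0 < q := hepos.trans_le hq.1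
  obtain ⟨m, hm, hmq, hmG⟩ := h.exists_descent hρ hρ2 hq0 hq.2 (h0 q hq0.le hq.2)
    (hlow q hq0.le hq.2)
  have hmG' : G a ≤ G m := le_trans hqG hmG
  have : q ≤ m := hql ⟨⟨hmem m hm (by linarith [hq.2]) hmG', by linarith [hq.2]⟩, hmG'⟩
  linarith

/-- The drop on `[0,1]` agrees with the drop on some `[0,a]` such that `f a < f x` on
`[a/2,a)`. -/
theorem exists_stuck (h : IsDropLike f τ) (h1 : 0 < τ 1) :
    ∃ a, 0 < a ∧ a ≤ 1 ∧ τ 1 ≤ τ a ∧ ∀ x ∈ Ico (a / 2) a, f a < f x := by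
  have hK : IsCompact (Icc (τ 1) 1 ∩ τ ⁻¹' Ici (τ 1)) :=
    isCompact_Icc.of_isClosed_subset
      ((h.continuousOn_drop h1).preimage_isClosed_of_isClosed isClosed_Icc isClosed_Ici)
      inter_subset_left
  obtain ⟨a, ⟨ha, haτ⟩, hal⟩ := hK.exists_isLeast
    ⟨1, ⟨h.le_self 1 one_pos le_rfl, le_rfl⟩, le_refl (τ 1)⟩
  have haτ : τ 1 ≤ τ a := haτ
  have ha0 : 0 < a := h1.trans_le ha.1
  refine ⟨a, ha0, ha.2, haτ, ?_⟩
  by_contra! hns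
  obtain ⟨m, hm, -, hτ⟩ := h.exists_min_of_not_stuck ha0 ha.2 hns
  have hm0 : 0 < m := by linarith [hm.1]
  have hm1 : m ≤ 1 := hm.2.le.trans ha.2
  have : a ≤ m := hal ⟨⟨(haτ.trans hτ).trans (h.le_self m hm0 hm1), hm1⟩, haτ.trans hτ⟩
  linarith [hm.2]

/-- The bound for the drop on `[0,a]` in terms of the value of `f` at a point
`x₀ ≤ a`. -/
theorem drop_le_of_dip (h : IsDropLike f τ) {ρ a x₀ L : ℝ} (hρ : 0 < ρ) (hρ2 : ρ < 2)
    (h0 : ∀ x, 0 ≤ x → x ≤ 1 → 0 ≤ f x)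
    (hlow : ∀ x, 0 ≤ x → x ≤ 1 → (1 - 2 * ρ) * x ≤ (2 - ρ) * f x)
    (ha1 : a ≤ 1) (hstuck : ∀ x ∈ Ico (a / 2) a, f a < f x)
    (hx₀ : 0 < x₀) (hxa : x₀ ≤ a) (hL0 : f x₀ + ρ * x₀ ≤ L)
    (hLS : (1 + ρ) * (f a + a) ≤ 3 * L + (2 - ρ) * (x₀ - f x₀)) :
    (1 + ρ) * τ a ≤ L - (1 + ρ) * f a := by
  have ha : 0 < a := hx₀.trans_le hxa
  rcases le_or_gt (f a + ρ * a) L with hle | hlt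
  · have := h.drop_le hρ hρ2 h0 hlow ha ha1
    linarith
  have hL : 0 < L := by
    have := h0 x₀ hx₀.le (hxa.trans ha1)
    nlinarith
  obtain ⟨b, hb, -, hba, hbe, hgap⟩ := h.exists_last (l := x₀) (c' := a) (c := a)
    (S := f a + a) (Φ := x₀ - f x₀) (L := L) hρ hρ2 hx₀.le hxa le_rfl ha1 hL
    (fun x hx => by have := (h.lip x a (hx₀.le.trans hx.1) hx.2 ha1).1; linarith)
    (fun x hx => by have := (h.lip x₀ x hx₀.le hx.1 (hx.2.trans ha1)).2; linarith)
    hLS hL0 hlt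
    (fun x hx => by rw [le_antisymm hx.2 hx.1]; exact hlt.le)
  have e1 := h.le_of_gap hb hba ha1 (h.min_of_gap hb ha1 hstuck hgap) hgap
  have e2 := h.drop_le hρ hρ2 h0 hlow hb (hba.trans ha1)
  nlinarith

/-- The bound for the drop on `[0,a]` in terms of the value of `f` at a point
`x₀ ∈ [a/2,a)`. -/
theorem drop_le_of_near (h : IsDropLike f τ) {ρ a x₀ : ℝ} (hρ : 0 < ρ) (hρ2 : ρ < 2)
    (h0 : ∀ x, 0 ≤ x → x ≤ 1 → 0 ≤ f x)
    (hlow : ∀ x, 0 ≤ x → x ≤ 1 → (1 - 2 * ρ) * x ≤ (2 - ρ) * f x)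
    (ha : 0 < a) (ha1 : a ≤ 1) (hstuck : ∀ x ∈ Ico (a / 2) a, f a < f x)
    (hx₀ : a / 2 ≤ x₀) (hxa : x₀ < a) :
    τ a ≤ (x₀ + f x₀) / 3 - f a ∨
      (1 + ρ) * τ a ≤ f x₀ + ρ * a / 2 - (1 + ρ) * f a := by
  have hcont : ContinuousOn f (Icc (a / 2) x₀) := h.contOn (by linarith) (by linarith)
  obtain ⟨y, hy, hymin⟩ := isCompact_Icc.exists_isMinOn (nonempty_Icc.2 hx₀) hcont
  have hymin' : ∀ x ∈ Icc (a / 2) x₀, f y ≤ f x := fun x hx => hymin hx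
  have hK : IsCompact (Icc (a / 2) x₀ ∩ f ⁻¹' Iic (f y)) :=
    isCompact_Icc.of_isClosed_subset
      (hcont.preimage_isClosed_of_isClosed isClosed_Icc isClosed_Iic) inter_subset_left
  obtain ⟨z, ⟨hz, hzy⟩, hzl⟩ := hK.exists_isLeast ⟨y, hy, le_refl (f y)⟩
  have hzy : f z ≤ f y := hzy
  have hzmin : ∀ x ∈ Icc (a / 2) x₀, f z ≤ f x := fun x hx => hzy.trans (hymin' x hx)
  have hzlt : ∀ x ∈ Ico (a / 2) z, f z < f x := by
    intro x hx
    by_contra! hle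
    have : z ≤ x := hzl ⟨⟨hx.1, hx.2.le.trans hz.2⟩, hle.trans hzy⟩
    linarith [hx.2]
  have hz0 : 0 < z := by linarith [hz.1]
  have hz1 : z ≤ 1 := by linarith [hz.2]
  have hfz : f z ≤ f x₀ := hzmin x₀ ⟨hx₀, le_rfl⟩
  have hfz0 := h0 z hz0.le hz1
  have ez := h.step z a (f a) hz0 (by linarith [hz.2]) (by linarith [hz.1]) ha1 fun x hx => by
    rcases eq_or_lt_of_le hx.2 with rfl | hxa
    · exact le_rfl
    · exact (hstuck x ⟨hz.1.trans hx.1, hxa⟩).le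
  by_cases hns : ∃ c ∈ Ico (z / 2) z, f c ≤ f z
  · right
    obtain ⟨m, hm, hmz, hτ⟩ := h.exists_min_of_not_stuck hz0 hz1 hns
    have hm0 : 0 < m := by linarith [hm.1]
    have hma : m ≤ a / 2 := by
      by_contra! hlt
      exact absurd (hzlt m ⟨hlt.le, hm.2⟩) hmz.not_gt
    obtain ⟨w, hw, hfw⟩ := intermediate_value_Icc hma (h.contOn hm0.le (by linarith))
      ⟨hmz, hzmin (a / 2) ⟨le_rfl, hx₀⟩⟩
    have e1 := (h.lip m w hm0.le hw.1 (by linarith [hw.2])).2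
    have e2 := h.drop_le hρ hρ2 h0 hlow hm0 (by linarith)
    have e3 : ρ * (m - f m) ≤ ρ * (a / 2 - f z) :=
      mul_le_mul_of_nonneg_left (by linarith [hw.2]) hρ.le
    have e4 : (1 + ρ) * τ a ≤ (1 + ρ) * (f z - f a + τ m) :=
      mul_le_mul_of_nonneg_left (by linarith) (by linarith)
    linarith
  push Not at hns
  left
  have hs : z + f z ≤ x₀ + f x₀ := by linarith [hz.2]
  have fin : ∀ b, 0 < b → b ≤ 1 → f b + ρ * b ≤ (1 + ρ) * (z + f z) / 3 →
      τ a ≤ f b - f a + τ b → τ a ≤ (x₀ + f x₀) / 3 - f a := by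
    intro b hb hb1 hg hτ
    have e2 := h.drop_le hρ hρ2 h0 hlow hb hb1
    have e4 : (1 + ρ) * τ a ≤ (1 + ρ) * (f b - f a + τ b) :=
      mul_le_mul_of_nonneg_left hτ (by linarith)
    have : (1 + ρ) * τ a ≤ (1 + ρ) * ((z + f z) / 3 - f a) := by linarith
    have := le_of_mul_le_mul_left this (by linarith)
    linarith
  rcases le_or_gt (f z + ρ * z) ((1 + ρ) * (z + f z) / 3) with hle | hlt
  · exact fin z hz0 hz1 hle ez
  obtain ⟨b, hb, -, hba, hbe, hgap⟩ := h.exists_last (l := 0) (c' := z) (c := z)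
    (S := z + f z) (Φ := 0) (L := (1 + ρ) * (z + f z) / 3) hρ hρ2 le_rfl hz0.le le_rfl hz1
    (by positivity)
    (fun x hx => by have := (h.lip x z hx.1 hx.2 hz1).1; linarith)
    (fun x hx => by have := h.le_id hx.1 (hx.2.trans hz1); linarith)
    (by linarith) (by rw [h.map_zero, mul_zero, add_zero]; positivity) hlt
    (fun x hx => by rw [le_antisymm hx.2 hx.1]; exact hlt.le)
  have e1 := h.le_of_gap hb hba hz1 (h.min_of_gap hb hz1 hns hgap) hgap
  exact fin b hb (hba.trans hz1) hbe.le (by linarith)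

end IsDropLike

namespace IsGoodPartition

variable {a : ℝ} {u : ℕ → ℝ}

theorem strictAnti (h : IsGoodPartition a u) : StrictAnti u :=
  strictAnti_nat_of_succ_lt h.2.2.1

theorem le_left (h : IsGoodPartition a u) (n : ℕ) : u n ≤ a :=
  h.1 ▸ h.strictAnti.antitone (Nat.zero_le n)

end IsGoodPartition

theorem isGoodPartition_geometric {a : ℝ} (ha : 0 < a) :
    IsGoodPartition a fun n => a * (1 / 2) ^ n := by
  refine ⟨by simp, fun n => by positivity, fun n => ?_, ?_, fun n => ?_⟩
  · have : 0 < a * (1 / 2) ^ n := by positivity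
    simp only [pow_succ]
    linarith
  · simpa using (tendsto_pow_atTop_nhds_zero_of_lt_one (by norm_num : (0 : ℝ) ≤ 1 / 2)
      (by norm_num)).const_mul a
  · exact le_of_eq (by simp only [pow_succ]; ring)

/-- The two-sided form of the `1`-Lipschitz condition on `[0,1]`. -/
def IsLip (f : ℝ → ℝ) : Prop :=
  ∀ x y, 0 ≤ x → x ≤ y → y ≤ 1 → f x - f y ≤ y - x ∧ f y - f x ≤ y - x

namespace IsLip

variable {f : ℝ → ℝ}

theorem sub_le_sInf (hf : IsLip f) {c a : ℝ} (hc : 0 ≤ c) (hca : c ≤ a) (ha : a ≤ 1) :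
    f c - (a - c) ≤ sInf (f '' Icc c a) := by
  refine le_csInf ((nonempty_Icc.2 hca).image f) ?_
  rintro _ ⟨x, hx, rfl⟩
  have := (hf c x hc hx.1 (hx.2.trans ha)).1
  linarith [hx.2]

theorem bddBelow_image (hf : IsLip f) {c a : ℝ} (hc : 0 ≤ c) (ha : a ≤ 1) :
    BddBelow (f '' Icc c a) := by
  refine ⟨f c - (a - c), ?_⟩
  rintro _ ⟨x, hx, rfl⟩
  have := (hf c x hc hx.1 (hx.2.trans ha)).1
  linarith [hx.2]

theorem sInf_le (hf : IsLip f) {c a : ℝ} (hc : 0 ≤ c) (hca : c ≤ a) (ha : a ≤ 1) :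
    sInf (f '' Icc c a) ≤ f c :=
  csInf_le (hf.bddBelow_image hc ha) ⟨c, ⟨le_rfl, hca⟩, rfl⟩

theorem term_nonneg (hf : IsLip f) {a : ℝ} {u : ℕ → ℝ} (ha : a ≤ 1)
    (hu : IsGoodPartition a u) (n : ℕ) :
    0 ≤ f (u (n + 1)) - sInf (f '' Icc (u (n + 1)) (u n)) :=
  sub_nonneg.2 (hf.sInf_le (hu.2.1 _).le (hu.2.2.1 n).le ((hu.le_left n).trans ha))

theorem sum_le (hf : IsLip f) {a : ℝ} {u : ℕ → ℝ} (ha : a ≤ 1)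
    (hu : IsGoodPartition a u) (n : ℕ) :
    ∑ i ∈ Finset.range n, (f (u (i + 1)) - sInf (f '' Icc (u (i + 1)) (u i))) ≤ a := by
  calc _ ≤ ∑ i ∈ Finset.range n, (u i - u (i + 1)) := by
        refine Finset.sum_le_sum fun i _ => ?_
        have := hf.sub_le_sInf (hu.2.1 (i + 1)).le (hu.2.2.1 i).le ((hu.le_left i).trans ha)
        linarith
    _ = u 0 - u n := Finset.sum_range_sub' u n
    _ ≤ a := by rw [hu.1]; linarith [hu.2.1 n]

theorem summable (hf : IsLip f) {a : ℝ} {u : ℕ → ℝ} (ha : a ≤ 1)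
    (hu : IsGoodPartition a u) :
    Summable fun n => f (u (n + 1)) - sInf (f '' Icc (u (n + 1)) (u n)) :=
  summable_of_sum_range_le (hf.term_nonneg ha hu) (hf.sum_le ha hu)

theorem totalDrop_nonneg (hf : IsLip f) {a : ℝ} {u : ℕ → ℝ} (ha : a ≤ 1)
    (hu : IsGoodPartition a u) : 0 ≤ totalDrop f u :=
  tsum_nonneg (hf.term_nonneg ha hu)

theorem drop_le_totalDrop (hf : IsLip f) {a : ℝ} {u : ℕ → ℝ} (ha : a ≤ 1)
    (hu : IsGoodPartition a u) : drop a f ≤ totalDrop f u := by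
  refine csInf_le ⟨0, ?_⟩ ⟨u, hu, rfl⟩
  rintro _ ⟨w, hw, rfl⟩
  exact hf.totalDrop_nonneg ha hw

theorem le_drop {a t : ℝ} (ha : 0 < a)
    (h : ∀ u, IsGoodPartition a u → t ≤ totalDrop f u) : t ≤ drop a f := by
  refine le_csInf ⟨_, _, isGoodPartition_geometric ha, rfl⟩ ?_
  rintro _ ⟨w, hw, rfl⟩
  exact h w hw

theorem drop_le_self (hf : IsLip f) {a : ℝ} (ha : 0 < a) (ha1 : a ≤ 1) : drop a f ≤ a :=
  (hf.drop_le_totalDrop ha1 (isGoodPartition_geometric ha)).trans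
    (Real.tsum_le_of_sum_range_le (hf.term_nonneg ha1 (isGoodPartition_geometric ha))
      (hf.sum_le ha1 (isGoodPartition_geometric ha)))

theorem drop_step (hf : IsLip f) {c a m : ℝ} (hc : 0 < c) (hca : c ≤ a) (ha2 : a ≤ 2 * c)
    (ha1 : a ≤ 1) (hm : ∀ x ∈ Icc c a, m ≤ f x) : drop a f ≤ f c - m + drop c f := by
  rcases eq_or_lt_of_le hca with rfl | hlt
  · linarith [hm c ⟨le_rfl, le_rfl⟩]
  suffices drop a f - (f c - m) ≤ drop c f by linarith
  refine le_drop hc fun u hu => ?_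
  set w : ℕ → ℝ := fun n => Nat.casesOn n a u
  have hw0 : w 0 = a := rfl
  have hws : ∀ n, w (n + 1) = u n := fun _ => rfl
  have hwg : IsGoodPartition a w := by
    refine ⟨rfl, ?_, ?_, ?_, ?_⟩
    · rintro (_ | n)
      · exact hc.trans hlt
      · exact hu.2.1 n
    · rintro (_ | n)
      · rw [hws, hu.1]; exact hlt
      · exact hu.2.2.1 n
    · exact (Filter.tendsto_add_atTop_iff_nat 1).1 hu.2.2.2.1
    · rintro (_ | n)
      · rw [hws, hu.1]; exact ha2
      · exact hu.2.2.2.2 n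
  have e1 := hf.drop_le_totalDrop ha1 hwg
  have e2 : totalDrop f w = (f (w 1) - sInf (f '' Icc (w 1) (w 0))) + totalDrop f u :=
    (hf.summable ha1 hwg).tsum_eq_zero_add
  rw [hw0, show w 1 = c from hu.1] at e2
  have e3 : m ≤ sInf (f '' Icc c a) := by
    refine le_csInf ((nonempty_Icc.2 hca).image f) ?_
    rintro _ ⟨x, hx, rfl⟩
    exact hm x hx
  linarith

theorem drop_mono (hf : IsLip f) {c a : ℝ} (hc : 0 < c) (hca : c ≤ a) (ha1 : a ≤ 1) :
    drop c f ≤ drop a f := by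
  refine le_drop (hc.trans_le hca) fun u hu => ?_
  have hex : ∃ n, u n < c := (hu.2.2.2.1.eventually_lt_const hc).exists
  obtain ⟨k, hk⟩ : ∃ k, Nat.find hex = k + 1 := by
    refine Nat.exists_eq_succ_of_ne_zero fun h0 => ?_
    have := Nat.find_spec hex
    rw [h0, hu.1] at this
    linarith
  have hkc : u (k + 1) < c := hk ▸ Nat.find_spec hex
  have hkc' : c ≤ u k := not_lt.1 (Nat.find_min hex (by omega))
  set w : ℕ → ℝ := fun n => Nat.casesOn n c fun n => u (n + (k + 1))
  have hw0 : w 0 = c := rfl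
  have hws : ∀ n, w (n + 1) = u (n + (k + 1)) := fun _ => rfl
  have hwg : IsGoodPartition c w := by
    refine ⟨rfl, ?_, ?_, ?_, ?_⟩
    · rintro (_ | n)
      · exact hc
      · exact hu.2.1 _
    · rintro (_ | n)
      · rw [hws, zero_add]; exact hkc
      · rw [hws, hws]; exact hu.strictAnti (by omega)
    · exact (Filter.tendsto_add_atTop_iff_nat 1).1
        ((Filter.tendsto_add_atTop_iff_nat (k + 1)).2 hu.2.2.2.1)
    · rintro (_ | n)
      · rw [hws, zero_add]; exact hkc'.trans (hu.2.2.2.2 k)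
      · have := hu.2.2.2.2 (n + (k + 1))
        rw [hws, hws]
        convert this using 3
        omega
  have hc1 : c ≤ 1 := hca.trans ha1
  refine (hf.drop_le_totalDrop hc1 hwg).trans ?_
  have e2 : totalDrop f w = (f (w 1) - sInf (f '' Icc (w 1) (w 0))) +
      ∑' n, (f (w (n + 1 + 1)) - sInf (f '' Icc (w (n + 1 + 1)) (w (n + 1)))) :=
    (hf.summable hc1 hwg).tsum_eq_zero_add
  have e3 := (hf.summable ha1 hu).sum_add_tsum_nat_add (k + 1)
  have e4 : (∑' n, (f (w (n + 1 + 1)) - sInf (f '' Icc (w (n + 1 + 1)) (w (n + 1))))) =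
      ∑' n, (f (u (n + (k + 1) + 1)) -
        sInf (f '' Icc (u (n + (k + 1) + 1)) (u (n + (k + 1))))) := by
    refine tsum_congr fun n => ?_
    rw [hws, hws, show n + 1 + (k + 1) = n + (k + 1) + 1 by omega]
  rw [Finset.sum_range_succ] at e3
  have e5 : 0 ≤ ∑ i ∈ Finset.range k, (f (u (i + 1)) - sInf (f '' Icc (u (i + 1)) (u i))) :=
    Finset.sum_nonneg fun i _ => hf.term_nonneg ha1 hu i
  have e6 : sInf (f '' Icc (u (k + 1)) (u k)) ≤ sInf (f '' Icc (u (k + 1)) c) :=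
    csInf_le_csInf (hf.bddBelow_image (hu.2.1 _).le ((hu.le_left k).trans ha1))
      ((nonempty_Icc.2 hkc.le).image f) (image_mono (Icc_subset_Icc le_rfl hkc'))
  rw [e4, hw0, show w 1 = u (k + 1) from (hws 0).trans (by rw [zero_add])] at e2
  rw [e2]
  change _ ≤ ∑' n, (f (u (n + 1)) - sInf (f '' Icc (u (n + 1)) (u n)))
  linarith

theorem isDropLike (hf : IsLip f) (h0 : f 0 = 0) (hcont : ContinuousOn f (Icc 0 1)) :
    IsDropLike f fun x => drop x f where
  map_zero := h0
  lip := hf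
  cont := hcont
  le_self _ := hf.drop_le_self
  mono _ _ := hf.drop_mono
  step _ _ _ := hf.drop_step

end IsLip

theorem dip_arith {D t a : ℝ} (hD0 : 0 ≤ D) (hD1 : D < 1 / 3)
    (ht : 6 * (3 - 4 * D + 5 * D ^ 2) * t = 1 + D) (ht6 : t ≤ 1 / 6) (ha1 : a ≤ 1)
    (hat : 1 - t ≤ a) :
    (2 - D) * (2 / 9 * (1 + D) + D * ((1 - 2 * D) * t) / 3) +
      (1 - 8 * D + 6 * D ^ 2) / 2 * a ≤ 3 * (1 - D) * ((1 - 2 * D) * (1 - t) / 3) := by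
  have hq : 0 < 3 - 4 * D + 5 * D ^ 2 := by nlinarith
  have e3 : (3 - D - D ^ 2) * ((1 - 2 * D) * t) / 3 ≤ 1 / 18 + 7 / 9 * (D - D ^ 2) := by
    have : 0 ≤ D * (42 - 87 * D + 123 * D ^ 2 - 72 * D ^ 3) :=
      mul_nonneg hD0 (by nlinarith [pow_nonneg hD0 2, pow_nonneg hD0 3])
    by_contra! hlt
    nlinarith [mul_pos hq (sub_pos.2 hlt)]
  have e4 : (3 - D - D ^ 2) * ((1 - 2 * D) * t) / 3 ≤
      5 / 36 + D / 9 - 5 / 18 * D ^ 2 := by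
    have e5 : (3 - D - D ^ 2) * ((1 - 2 * D) * t) ≤
        (3 - D - D ^ 2) * ((1 - 2 * D) * (1 / 6)) := by
      have : 0 ≤ 3 - D - D ^ 2 := by nlinarith
      have : 0 ≤ 1 - 2 * D := by linarith
      gcongr
    nlinarith [pow_nonneg hD0 2, pow_nonneg hD0 3]
  rcases le_total 0 (1 - 8 * D + 6 * D ^ 2) with hc | hc
  · have : (1 - 8 * D + 6 * D ^ 2) / 2 * a ≤ (1 - 8 * D + 6 * D ^ 2) / 2 * 1 :=
      mul_le_mul_of_nonneg_left ha1 (by linarith)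
    linarith
  · have : (1 - 8 * D + 6 * D ^ 2) / 2 * a ≤ (1 - 8 * D + 6 * D ^ 2) / 2 * (5 / 6) :=
      mul_le_mul_of_nonpos_left (by linarith) (by linarith)
    linarith

theorem IsDropLike.drop_one_le {f τ : ℝ → ℝ} (h : IsDropLike f τ) {D t x₀ : ℝ} (hD0 : 0 ≤ D)
    (hD1 : D < 1 / 3) (ht : 6 * (3 - 4 * D + 5 * D ^ 2) * t = 1 + D)
    (hlow : ∀ x ∈ Icc (0 : ℝ) 1, D * x ≤ f x) (hx₀ : 0 ≤ x₀)
    (hx₀ξ : x₀ ≤ 2 / 3 * (1 + D) + (1 - 2 * D) ^ 2 * t)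
    (hdip : f x₀ < x₀ / 3 - (1 - 3 * D) * (1 - 2 * D) * t / 3) :
    τ 1 ≤ (1 - 2 * D) * (1 - t) / 3 := by
  have hq : 0 < 3 - 4 * D + 5 * D ^ 2 := by nlinarith
  have ht0 : 0 < t := by
    by_contra! hle
    nlinarith
  have ht6 : t ≤ 1 / 6 := by
    by_contra! hlt
    nlinarith [mul_pos hq (sub_pos.2 hlt), sq_nonneg (D - 1 / 2)]
  have hξ : 2 / 3 * (1 + D) + (1 - 2 * D) ^ 2 * t < 1 - t := by
    have h1 : 0 < 2 * (1 - 3 * D) * (2 - 3 * D + 4 * D ^ 2) := by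
      have : 0 < 1 - 3 * D := by linarith
      have : 0 < 2 - 3 * D + 4 * D ^ 2 := by nlinarith
      positivity
    by_contra! hle
    nlinarith [mul_nonneg hq.le (sub_nonneg.2 hle)]
  have hK : 0 < (1 - 2 * D) * (1 - t) / 3 := by
    have : 0 < 1 - 2 * D := by linarith
    have : 0 < 1 - t := by linarith
    positivity
  rcases le_or_gt (τ 1) 0 with hneg | hpos
  · linarith
  set ρ : ℝ := (1 - 2 * D) / (2 - D) with hρdef
  have h2D : 0 < 2 - D := by linarith
  have hρD : (2 - D) * ρ = 1 - 2 * D := by rw [hρdef]; field_simp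
  have hρ : 0 < ρ := div_pos (by linarith) h2D
  have hρ2 : ρ < 2 := by rw [hρdef, div_lt_iff₀ h2D]; linarith
  have h0 : ∀ x, 0 ≤ x → x ≤ 1 → 0 ≤ f x := fun x hx hx1 =>
    (mul_nonneg hD0 hx).trans (hlow x ⟨hx, hx1⟩)
  have hlow' : ∀ x, 0 ≤ x → x ≤ 1 → (1 - 2 * ρ) * x ≤ (2 - ρ) * f x := by
    intro x hx hx1
    have e1 : 1 - 2 * ρ = (2 - ρ) * D := by linarith
    have := mul_le_mul_of_nonneg_left (hlow x ⟨hx, hx1⟩) (by linarith : 0 ≤ 2 - ρ)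
    rw [e1]
    linarith
  obtain ⟨a, ha, ha1, hτa, hstuck⟩ := h.exists_stuck hpos
  refine hτa.trans ?_
  have hva := hlow a ⟨ha.le, ha1⟩
  have scale : ∀ y z, (1 + ρ) * y ≤ z → 3 * (1 - D) * y ≤ (2 - D) * z := by
    intro y z hyz
    have := mul_le_mul_of_nonneg_left hyz h2D.le
    calc 3 * (1 - D) * y = (2 - D + (2 - D) * ρ) * y := by rw [hρD]; ring
      _ ≤ _ := by linarith
  have unscale : ∀ y z : ℝ, 3 * (1 - D) * y ≤ 3 * (1 - D) * z → y ≤ z := fun y z hyz =>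
    le_of_mul_le_mul_left hyz (by linarith)
  rcases lt_or_ge a (1 - t) with hat | hat
  · have e1 := scale _ _ (h.drop_le hρ hρ2 h0 hlow' ha ha1)
    apply unscale
    have e2 : (2 - D) * (ρ * (a - f a)) = (1 - 2 * D) * (a - f a) := by
      rw [← mul_assoc, hρD]
    have e3 : (1 - 2 * D) * (a - f a) ≤ (1 - 2 * D) * ((1 - D) * (1 - t)) :=
      mul_le_mul_of_nonneg_left (by nlinarith) (by linarith)
    linarith
  have hx₀a : x₀ < a := by linarith
  have hx₀D := hlow x₀ ⟨hx₀, by linarith⟩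
  have hx₀t : (1 - 2 * D) * t ≤ x₀ := by
    by_contra! hlt
    nlinarith
  have hx₀pos : 0 < x₀ := lt_of_lt_of_le (mul_pos (by linarith) ht0) hx₀t
  have hfx₀ : f x₀ ≤ 2 / 9 * (1 + D) + D * ((1 - 2 * D) * t) / 3 := by linarith
  have hfinal : (2 - D) * f x₀ + (1 - 2 * D) * a / 2 - 3 * (1 - D) * f a ≤
      3 * (1 - D) * ((1 - 2 * D) * (1 - t) / 3) := by
    have e1 := mul_le_mul_of_nonneg_left hfx₀ h2D.le
    have e2 := mul_le_mul_of_nonneg_left hva (by linarith : 0 ≤ 3 * (1 - D))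
    have e3 := dip_arith hD0 hD1 ht ht6 ha1 hat
    linarith
  rcases le_or_gt (a / 2) x₀ with hnear | hfar
  · rcases h.drop_le_of_near hρ hρ2 h0 hlow' ha ha1 hstuck hnear hx₀a with e1 | e1
    · have e2 : (1 + D) / 9 = (3 - 4 * D + 5 * D ^ 2) * t * (2 / 3) := by linarith
      have e3 : D * (1 - t) ≤ f a := (mul_le_mul_of_nonneg_left hat hD0).trans hva
      linarith
    · apply unscale
      have e2 := scale _ _ (by linarith :
        (1 + ρ) * (τ a + f a) ≤ f x₀ + ρ * a / 2)
      have e3 : (2 - D) * (ρ * a / 2) = (1 - 2 * D) * a / 2 := by rw [← hρD]; ring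
      linarith
  · apply unscale
    set M := ((1 + ρ) * (f a + a) - (2 - ρ) * (x₀ - f x₀)) / 3 with hM
    rcases le_total (f x₀ + ρ * x₀) M with hle | hle
    · have e1 := h.drop_le_of_dip (L := M) hρ hρ2 h0 hlow' ha1 hstuck hx₀pos hx₀a.le hle
        (by rw [hM]; linarith)
      have e2 := scale _ _ (by linarith : (1 + ρ) * (τ a + f a) ≤ M)
      have e3 : (2 - D) * M = (1 - D) * (f a + a) - (x₀ - f x₀) := by
        rw [hM]
        linear_combination ((f a + a) / 3 + (x₀ - f x₀) / 3) * hρD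
      have e4 : (1 - D) * (a - 2 * f a) ≤ (1 - D) * (1 - 2 * D) := by
        refine mul_le_mul_of_nonneg_left ?_ (by linarith)
        have := mul_le_mul_of_nonneg_left ha1 (by linarith : 0 ≤ 1 - 2 * D)
        linarith
      linarith
    · have e1 := h.drop_le_of_dip (L := f x₀ + ρ * x₀) hρ hρ2 h0 hlow' ha1 hstuck hx₀pos
        hx₀a.le le_rfl (by rw [hM] at hle; linarith)
      have e2 := scale _ _ (by linarith : (1 + ρ) * (τ a + f a) ≤ f x₀ + ρ * x₀)
      have e3 : (2 - D) * (ρ * x₀) = (1 - 2 * D) * x₀ := by rw [← mul_assoc, hρD]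
      have e4 : (1 - 2 * D) * x₀ ≤ (1 - 2 * D) * (a / 2) :=
        mul_le_mul_of_nonneg_left hfar.le (by linarith)
      linarith

/-- **Corollary.** Let `D ∈ [0,1/3)` and `Λ(D) = (1+D)(37 − 50D + 60D²)/(18(3 − 4D + 5D²))`;
then `Λ(D) ≥ 37/54`, and there are `η > 0` and `ξ ∈ (2/3, 1]` with `Λ(D) = ξ(1 − 2η)` such
that every `1`-Lipschitz `f : [0,1] → ℝ` with `f(0) = 0`, `f(x) ≥ Dx` and
`T(f) > 1 − Λ(D)` satisfies `f(x) ≥ x/3 − ηξ` on `[0, ξ]`. -/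
theorem statement18 (D : ℝ) (hD : D ∈ Set.Ico (0 : ℝ) (1 / 3)) :
    (37 / 54 : ℝ) ≤
      (1 + D) * (37 - 50 * D + 60 * D ^ 2) / (18 * (3 - 4 * D + 5 * D ^ 2)) ∧
    ∃ η ξ : ℝ, 0 < η ∧ ξ ∈ Set.Ioc (2 / 3 : ℝ) 1 ∧
      (1 + D) * (37 - 50 * D + 60 * D ^ 2) / (18 * (3 - 4 * D + 5 * D ^ 2)) =
        ξ * (1 - 2 * η) ∧
      ∀ f : ℝ → ℝ, LipschitzOnWith 1 f (Set.Icc 0 1) → f 0 = 0 →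
        (∀ x ∈ Set.Icc (0 : ℝ) 1, D * x ≤ f x) →
        1 - (1 + D) * (37 - 50 * D + 60 * D ^ 2) / (18 * (3 - 4 * D + 5 * D ^ 2)) <
          drop 1 f →
        ∀ x ∈ Set.Icc (0 : ℝ) ξ, x / 3 - η * ξ ≤ f x := by
  obtain ⟨hD0, hD1⟩ := hD
  have hq : 0 < 3 - 4 * D + 5 * D ^ 2 := by nlinarith
  set t : ℝ := (1 + D) / (6 * (3 - 4 * D + 5 * D ^ 2)) with htdef
  have ht : 6 * (3 - 4 * D + 5 * D ^ 2) * t = 1 + D := mul_div_cancel₀ _ (by positivity)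
  have ht0 : 0 < t := by positivity
  have ht6 : t ≤ 1 / 6 := by
    rw [htdef, div_le_iff₀ (by positivity)]
    nlinarith [sq_nonneg (D - 1 / 2)]
  have hΛ : (1 + D) * (37 - 50 * D + 60 * D ^ 2) / (18 * (3 - 4 * D + 5 * D ^ 2)) =
      2 / 3 * (1 + D) + (1 - 2 * D) * t / 3 := by
    rw [div_eq_iff (by positivity)]
    linear_combination -(1 - 2 * D) * ht
  refine ⟨?_, ?_⟩
  · rw [le_div_iff₀ (by positivity)]
    nlinarith [pow_nonneg hD0 2, pow_nonneg hD0 3]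
  rw [hΛ]
  set ξ : ℝ := 2 / 3 * (1 + D) + (1 - 2 * D) ^ 2 * t with hξdef
  have h2 : 0 < 1 - 2 * D := by linarith
  have h3 : 0 < 1 - 3 * D := by linarith
  have hξ : 0 < ξ := by positivity
  set η : ℝ := (1 - 3 * D) * (1 - 2 * D) * t / 3 / ξ with hηdef
  have hηξ : η * ξ = (1 - 3 * D) * (1 - 2 * D) * t / 3 := by rw [hηdef]; field_simp
  refine ⟨η, ξ, by positivity, ⟨?_, ?_⟩, ?_, ?_⟩
  · have : 0 < (1 - 2 * D) ^ 2 * t := by positivity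
    linarith
  · have : (1 - 2 * D) ^ 2 * t ≤ (1 - 2 * D) ^ 2 * (1 / 6) := by gcongr
    nlinarith
  · linear_combination 2 * hηξ + hξdef
  intro f hL hf0 hlow hdrop x hx
  by_contra! hlt
  have hlip : IsLip f := by
    intro x y hx hxy hy
    have := hL.dist_le_mul x ⟨hx, hxy.trans hy⟩ y ⟨hx.trans hxy, hy⟩
    rw [Real.dist_eq, Real.dist_eq, abs_sub_comm x y, abs_of_nonneg (sub_nonneg.2 hxy),
      NNReal.coe_one, one_mul] at this
    have := abs_le.1 this
    exact ⟨this.2, by linarith [this.1]⟩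
  have := (hlip.isDropLike hf0 hL.continuousOn).drop_one_le hD0 hD1 ht hlow hx.1 hx.2
    (by rw [← hηξ]; exact hlt)
  linarith
end
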